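/- There exists a family (μ^ω)_{ω∈Ω} of finite Borel measures on J_∞, with ω ↦ μ^ω([i]) measurable for every i ∈ J, satisfying properties (b)–(d) below as well as the following change-of-label covariance: whenever ω, ω' ∈ Ω agree at every node 𝐚 ∈ J with 𝐚 ≠ 𝐢 (for some fixed 𝐢 ∈ J), then the restriction μ^ω|_{[𝐢]} = (r_𝐢^ω / r_𝐢^{ω'})^s · μ^{ω'}|_{[𝐢]}, and μ^ω|_{[𝐣]} = μ^{ω'}|_{[𝐣]} for every 𝐣 ∈ J incomparable with 𝐢. Here (b) for ℙ-a.e. ω, 0 < μ^ω(J_∞) < ∞; (c) E(μ^ω([i]) | 𝓕_k) = (𝐫_i^ω)^s ℙ-a.s. for every i ∈ J_k; (d) E(∑_{i ∈ J_k} μ^ω([i])) = 1 for every k. -/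

import Mathlib

open MeasureTheory Filter Topology
open scoped ENNReal

noncomputable section

abbrev E (d : ℕ) : Type := EuclideanSpace ℝ (Fin d)

abbrev Od (d : ℕ) : Type := Matrix.orthogonalGroup (Fin d) ℝ

instance (d : ℕ) : MeasurableSpace (Od d) := borel _
instance (d : ℕ) : BorelSpace (Od d) := ⟨rfl⟩

/-- The action of an orthogonal matrix on Euclidean space, as a linear map. -/
def act (d : ℕ) (Q : Od d) : E d →ₗ[ℝ] E d :=
  Matrix.toEuclideanLin (Q : Matrix (Fin d) (Fin d) ℝ)

/-- The set `J` of finite nonempty words: a word of length `k+1` is a function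
`Fin (k+1) → Fin m`. -/
abbrev JW (m : ℕ) : Type := Σ k : ℕ, (Fin (k + 1) → Fin m)

noncomputable instance (m : ℕ) : DecidableEq (JW m) := fun _ _ => Classical.dec _

/-- The label space `(σ₋,σ₊) × O(d)`. -/
abbrev Label (d : ℕ) (σm σp : ℝ) : Type := ↥(Set.Ioo σm σp) × Od d

/-- The space `Ω` of labelled trees. -/
abbrev Omega (d m : ℕ) (σm σp : ℝ) : Type := JW m → Label d σm σp

variable {d m : ℕ} {σm σp : ℝ}

/-- The similarity map `T_i^ω = r_i^ω • Q_i^ω` attached to the node `w`. -/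
def Tnode (ω : Omega d m σm σp) (w : JW m) : E d →ₗ[ℝ] E d :=
  ((ω w).1 : ℝ) • act d (ω w).2

/-- The initial word `𝐢_{k+1}` (first `k+1` symbols) of an infinite word `i`. -/
def pre (i : ℕ → Fin m) (k : ℕ) : JW m := ⟨k, fun j => i j.1⟩

/-- `cumT ω i n = T_{𝐢_1} ∘ ⋯ ∘ T_{𝐢_n}`. -/
def cumT (ω : Omega d m σm σp) (i : ℕ → Fin m) : ℕ → (E d →ₗ[ℝ] E d)
  | 0 => LinearMap.id
  | n + 1 => (cumT ω i n).comp (Tnode ω (pre i n))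

/-- `cumR ω i n = 𝐫_{𝐢_n}^ω = r_{𝐢_1}^ω ⋯ r_{𝐢_n}^ω` (equal to 1 if `n = 0`). -/
def cumR (ω : Omega d m σm σp) (i : ℕ → Fin m) (n : ℕ) : ℝ :=
  ∏ k ∈ Finset.range n, ((ω (pre i k)).1 : ℝ)

/-- `𝐫_w^ω` for a finite word `w`. -/
def wordR (ω : Omega d m σm σp) {k : ℕ} (w : Fin k → Fin m) : ℝ :=
  ∏ j : Fin k, ((ω ⟨j.1, fun t => w (Fin.castLE j.2 t)⟩).1 : ℝ)

/-- The `k`-th partial sum `a_{i_1} + T_{𝐢_1}(a_{i_2}) + ⋯ + T_{𝐢_1}∘⋯∘T_{𝐢_k}(a_{i_{k+1}})`. -/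
def partialSum (a : Fin m → E d) (ω : Omega d m σm σp) (i : ℕ → Fin m) (k : ℕ) : E d :=
  ∑ n ∈ Finset.range (k + 1), cumT ω i n (a (i n))

/-- The point `π(i, ω)`. -/
def piMap (a : Fin m → E d) (ω : Omega d m σm σp) (i : ℕ → Fin m) : E d :=
  ∑' n : ℕ, cumT ω i n (a (i n))

/-- `cumTFrom ω i p q = T_{𝐢_{p+2}} ∘ ⋯ ∘ T_{𝐢_{p+1+q}}`. -/
def cumTFrom (ω : Omega d m σm σp) (i : ℕ → Fin m) (p : ℕ) : ℕ → (E d →ₗ[ℝ] E d)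
  | 0 => LinearMap.id
  | q + 1 => (cumTFrom ω i p q).comp (Tnode ω (pre i (p + 1 + q)))

/-- The random vector `x(i, ω, p)`. -/
def xMap (a : Fin m → E d) (ω : Omega d m σm σp) (i : ℕ → Fin m) (p : ℕ) : E d :=
  ∑' q : ℕ, cumTFrom ω i p q (a (i (p + 1 + q)))

/-- The uniform probability measure on `(σ₋, σ₊)`, as a measure on `ℝ`. -/
def unif (σm σp : ℝ) : Measure ℝ :=
  (ENNReal.ofReal (σp - σm))⁻¹ • (volume.restrict (Set.Ioo σm σp))

/-- The uniform probability measure on `(σ₋, σ₊)`, as a measure on the subtype. -/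
def unifSub (σm σp : ℝ) : Measure ↥(Set.Ioo σm σp) :=
  (ENNReal.ofReal (σp - σm))⁻¹ • ((volume : Measure ℝ).comap Subtype.val)

/-- The measure `λ × θ` on the label space. -/
def labelM (σm σp : ℝ) {d : ℕ} (θ : Measure (Od d)) : Measure (Label d σm σp) :=
  (unifSub σm σp).prod θ

/-- The cylinder `[w]` of a finite word `w`. -/
def cyl {m k : ℕ} (w : Fin k → Fin m) : Set (ℕ → Fin m) := {j | ∀ t : Fin k, j t.1 = w t}

/-- The cylinder `[w]` of a node `w : JW m`. -/
def cylNode {m : ℕ} (w : JW m) : Set (ℕ → Fin m) := {j | ∀ t : Fin (w.1 + 1), j t.1 = w.2 t}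

/-- The σ-algebra `𝓕_k` generated by the labels at nodes of length at most `k`. -/
def Fk (d m : ℕ) (σm σp : ℝ) (k : ℕ) : MeasurableSpace (Omega d m σm σp) :=
  ⨆ w : {w : JW m // w.1 + 1 ≤ k}, MeasurableSpace.comap (fun ω => ω w.1) inferInstance

/-- `P` is the product measure `(λ×θ)^J`: coordinates are independent with law `λ×θ`. -/
def IsProductLaw (θ : Measure (Od d)) (P : Measure (Omega d m σm σp)) : Prop :=
  ∀ (S : Finset (JW m)) (A : JW m → Set (Label d σm σp)),
    (∀ w, MeasurableSet (A w)) →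
    P {ω | ∀ w ∈ S, ω w ∈ A w} = ∏ w ∈ S, labelM σm σp θ (A w)

/-- The uniformly random self-similar set `F(ω)`. -/
def Fset (a : Fin m → E d) (ω : Omega d m σm σp) : Set (E d) := Set.range (piMap a ω)

/-- `w` is an initial subword of `v`. -/
def isPrefix {m : ℕ} (w v : JW m) : Prop :=
  ∃ h : w.1 ≤ v.1, ∀ t : Fin (w.1 + 1), v.2 (Fin.castLE (Nat.succ_le_succ h) t) = w.2 t

end

section Aux
open scoped NNReal

theorem cyl_isClopen {m k : ℕ} (u : Fin k → Fin m) : IsClopen (cyl u) := by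
  have : cyl u = ⋂ t : Fin k, (fun j : ℕ → Fin m => j t.1) ⁻¹' {u t} := by
    ext j; simp [cyl]
  rw [this]
  exact isClopen_iInter_of_finite fun t => (isClopen_discrete _).preimage (continuous_apply _)

theorem cyl_meas {m k : ℕ} (u : Fin k → Fin m) : MeasurableSet (cyl u) :=
  (cyl_isClopen u).isOpen.measurableSet

theorem snoc_sum {m n : ℕ} {M : Type*} [AddCommMonoid M] (f : (Fin (n+1) → Fin m) → M) :
    ∑ w, f w = ∑ w : Fin n → Fin m, ∑ a : Fin m, f (Fin.snoc (α := fun _ => Fin m) w a) := by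
  rw [← (Fin.snocEquiv (fun _ : Fin (n+1) => Fin m)).sum_comp, Fintype.sum_prod_type, Finset.sum_comm]
  rfl

def wmatch {m n k : ℕ} (w : Fin n → Fin m) (u : Fin k → Fin m) : Prop :=
  ∀ t : Fin k, ∀ h : t.1 < n, w ⟨t.1, h⟩ = u t

open Classical in
theorem match_sum {m k : ℕ} (p : ∀ k, (Fin k → Fin m) → ℝ≥0)
    (hp : ∀ k u, p k u = ∑ a, p (k+1) (Fin.snoc (α := fun _ => Fin m) u a)) (u : Fin k → Fin m)
    (n : ℕ) (hn : k ≤ n) : ∑ w : Fin n → Fin m, (if wmatch w u then p n w else 0) = p k u := by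
  induction n, hn using Nat.le_induction with
  | base =>
    rw [Finset.sum_eq_single u]
    · rw [if_pos]; intro t h; rfl
    · intro w _ hw
      rw [if_neg]
      intro h; apply hw; funext t; exact h t t.2
    · simp
  | succ n hn ih =>
    rw [snoc_sum, ← ih]
    refine Finset.sum_congr rfl fun w _ => ?_
    have : ∀ a, wmatch (Fin.snoc (α := fun _ => Fin m) w a) u ↔ wmatch w u := by
      intro a
      refine forall_congr' fun t => ?_
      have ht : t.1 < n := by omega
      have h2 : t.1 < n + 1 := by omega
      simp [ht, h2, Fin.snoc]
    simp only [this]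
    split_ifs
    · rw [hp n w]
    · simp

theorem exists_measure {m : ℕ} [NeZero m] (p : ∀ k, (Fin k → Fin m) → ℝ≥0)
    (hp : ∀ k u, p k u = ∑ a, p (k+1) (Fin.snoc (α := fun _ => Fin m) u a)) :
    ∃ μ : Measure (ℕ → Fin m), IsFiniteMeasure μ ∧
      ∀ (k : ℕ) (u : Fin k → Fin m), μ (cyl u) = p k u := by
  classical
  let ext : ∀ n, (Fin n → Fin m) → (ℕ → Fin m) := fun n w t => if h : t < n then w ⟨t, h⟩ else 0
  let ν : ℕ → Measure (ℕ → Fin m) := fun n =>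
    ∑ w : Fin n → Fin m, (p n w) • Measure.dirac (ext n w)
  have hfin : ∀ n, IsFiniteMeasure (ν n) := fun n => by
    dsimp [ν]; infer_instance
  have hν : ∀ (k : ℕ) (u : Fin k → Fin m) (n : ℕ), k ≤ n → ν n (cyl u) = p k u := by
    intro k u n hn
    rw [← match_sum p hp u n hn]
    simp only [ν, Measure.coe_finsetSum, Finset.sum_apply, Measure.smul_apply, ENNReal.ofNNReal_finsetSum]
    refine Finset.sum_congr rfl fun w _ => ?_
    rw [Measure.dirac_apply' _ (cyl_meas u)]
    have : ext n w ∈ cyl u ↔ wmatch w u := by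
      refine forall_congr' fun t => ?_
      have ht : t.1 < n := by omega
      simp [ext, ht]
    by_cases h : wmatch w u
    · simp [h, this, ENNReal.smul_def]
    · simp [h, this]
  have hcu : cyl (Fin.elim0 : Fin 0 → Fin m) = Set.univ := by
    ext; simp [cyl]
  let ν' : ℕ → FiniteMeasure (ℕ → Fin m) := fun n => ⟨ν n, hfin n⟩
  have hmass : ∀ n, (ν' n).mass ≤ p 0 Fin.elim0 := by
    intro n
    have := hν 0 Fin.elim0 n (Nat.zero_le _)
    rw [hcu] at this
    rw [← ENNReal.coe_le_coe, FiniteMeasure.ennreal_mass]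
    exact this.le
  have hc := isCompact_setOfPred_finiteMeasure_le_of_compactSpace (ℕ → Fin m) (p 0 Fin.elim0)
  let U : Ultrafilter ℕ := Ultrafilter.of atTop
  have hU : (U : Filter ℕ) ≤ atTop := Ultrafilter.of_le atTop
  obtain ⟨μ, -, hμ⟩ := hc.ultrafilter_le_nhds (U.map ν') (by
    rw [le_principal_iff]
    exact Filter.mem_map.2 (Filter.univ_mem' hmass))
  have hT : Tendsto ν' U (𝓝 μ) := hμ
  refine ⟨μ, inferInstance, fun k u => ?_⟩
  rw [FiniteMeasure.tendsto_iff_forall_lintegral_tendsto] at hT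
  have h1 := hT (BoundedContinuousFunction.mkOfCompact
    ⟨(cyl u).indicator 1, (cyl_isClopen u).continuous_indicator continuous_one⟩)
  have h2 : ∀ ρ : Measure (ℕ → Fin m), ∫⁻ x, ((BoundedContinuousFunction.mkOfCompact
    ⟨(cyl u).indicator (1 : (ℕ → Fin m) → ℝ≥0),
      (cyl_isClopen u).continuous_indicator continuous_one⟩ x : ℝ≥0) : ℝ≥0∞) ∂ρ = ρ (cyl u) := by
    intro ρ
    rw [← lintegral_indicator_one (cyl_meas u)]
    congr 1
    funext x
    by_cases hx : x ∈ cyl u <;> simp [hx]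
  simp only [h2] at h1
  have h3 : Tendsto (fun n => (ν' n : Measure (ℕ → Fin m)) (cyl u)) U (𝓝 (p k u)) := by
    refine Tendsto.congr' ?_ tendsto_const_nhds
    exact hU ((eventually_ge_atTop k).mono fun n hn => (hν k u n hn).symm)
  exact tendsto_nhds_unique h1 h3

theorem cyl_inter {m n k : ℕ} (v : Fin n → Fin m) (u : Fin k → Fin m) (h : k ≤ n)
    (hne : (cyl v ∩ cyl u).Nonempty) : wmatch v u ∧ cyl v ∩ cyl u = cyl v := by
  obtain ⟨x, hx1, hx2⟩ := hne
  have hm : wmatch v u := fun t ht => by rw [← hx1 ⟨t, ht⟩, ← hx2 t]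
  refine ⟨hm, Set.inter_eq_left.2 fun y hy t => ?_⟩
  rw [← hm t (by omega), ← hy ⟨t, by omega⟩]

theorem measure_ext_cyl {m k : ℕ} (μ ν : Measure (ℕ → Fin m)) [IsFiniteMeasure μ]
    (w : Fin k → Fin m)
    (h : ∀ (n : ℕ) (v : Fin n → Fin m), k ≤ n → wmatch v w → μ (cyl v) = ν (cyl v)) :
    μ.restrict (cyl w) = ν.restrict (cyl w) := by
  have hw : μ (cyl w) = ν (cyl w) := h k w le_rfl fun t _ => rfl
  refine ext_of_generate_finite {s | ∃ (n : ℕ) (v : Fin n → Fin m), s = cyl v} ?_ ?_ ?_ ?_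
  · apply le_antisymm
    · refine iSup_le fun t => ?_
      rintro _ ⟨A, -, rfl⟩
      have : (fun j : ℕ → Fin m => j t) ⁻¹' A =
          ⋃ v : {v : Fin (t+1) → Fin m // v (Fin.last t) ∈ A}, cyl v.1 := by
        ext j
        simp only [Set.mem_preimage, Set.mem_iUnion]
        constructor
        · intro hj
          exact ⟨⟨fun i => j i, hj⟩, fun i => rfl⟩
        · rintro ⟨v, hv⟩
          have := hv (Fin.last t)
          simp only [Fin.val_last] at this
          rw [this]; exact v.2
      rw [this]
      exact MeasurableSet.iUnion fun v => MeasurableSpace.measurableSet_generateFrom ⟨_, _, rfl⟩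
    · refine MeasurableSpace.generateFrom_le ?_
      rintro _ ⟨n, v, rfl⟩
      exact cyl_meas v
  · rintro _ ⟨n, v, rfl⟩ _ ⟨n', v', rfl⟩ hne
    rcases le_total n n' with hn | hn
    · rw [Set.inter_comm] at hne ⊢
      exact ⟨n', v', (cyl_inter v' v hn hne).2⟩
    · exact ⟨n, v, (cyl_inter v v' hn hne).2⟩
  · rintro _ ⟨n, v, rfl⟩
    rw [Measure.restrict_apply (cyl_meas v), Measure.restrict_apply (cyl_meas v)]
    rcases Set.eq_empty_or_nonempty (cyl v ∩ cyl w) with he | hne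
    · simp [he]
    rcases le_total k n with hn | hn
    · have := cyl_inter v w hn hne
      rw [this.2]
      exact h n v hn this.1
    · rw [Set.inter_comm] at hne ⊢
      rw [(cyl_inter w v hn hne).2, hw]
  · simp [hw]

end Aux
section Det
open scoped NNReal
variable {d m : ℕ} {σm σp : ℝ}

noncomputable def rs (s : ℝ) (ω : Omega d m σm σp) (v : JW m) : ℝ := ((ω v).1 : ℝ) ^ s

abbrev sn {m k : ℕ} (u : Fin k → Fin m) (a : Fin m) : Fin (k+1) → Fin m :=
  Fin.snoc (α := fun _ => Fin m) u a

noncomputable def MM (s : ℝ) (ω : Omega d m σm σp) : ℕ → ∀ k, (Fin k → Fin m) → ℝ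
  | 0, _, _ => 1
  | n+1, k, u => ∑ a : Fin m, rs s ω ⟨k, sn u a⟩ * MM s ω n (k+1) (sn u a)

def Good (s : ℝ) (ω : Omega d m σm σp) : Prop :=
  ∀ k (u : Fin k → Fin m), ∃ x, Tendsto (fun n => MM s ω n k u) atTop (𝓝 x)

noncomputable def XX (s : ℝ) (ω : Omega d m σm σp) (k : ℕ) (u : Fin k → Fin m) : ℝ :=
  (liminf (fun n => ENNReal.ofReal (MM s ω n k u)) atTop).toReal

theorem lab_pos (hσ0 : 0 < σm) (ω : Omega d m σm σp) (v : JW m) : 0 < ((ω v).1 : ℝ) :=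
  hσ0.trans (ω v).1.2.1

theorem rs_pos (hσ0 : 0 < σm) (s : ℝ) (ω : Omega d m σm σp) (v : JW m) : 0 < rs s ω v :=
  Real.rpow_pos_of_pos (lab_pos hσ0 ω v) s

theorem MM_nonneg (hσ0 : 0 < σm) (s : ℝ) (ω : Omega d m σm σp) (n k : ℕ) (u : Fin k → Fin m) :
    0 ≤ MM s ω n k u := by
  induction n generalizing k with
  | zero => simp [MM]
  | succ n ih =>
    exact Finset.sum_nonneg fun a _ => mul_nonneg (rs_pos hσ0 s ω _).le (ih _ _)

theorem XX_nonneg (s : ℝ) (ω : Omega d m σm σp) (k : ℕ) (u : Fin k → Fin m) :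
    0 ≤ XX s ω k u := ENNReal.toReal_nonneg

theorem XX_eq (hσ0 : 0 < σm) {s : ℝ} {ω : Omega d m σm σp} {k : ℕ} {u : Fin k → Fin m} {x : ℝ}
    (h : Tendsto (fun n => MM s ω n k u) atTop (𝓝 x)) : XX s ω k u = x := by
  have h0 : 0 ≤ x := ge_of_tendsto' h fun n => MM_nonneg hσ0 s ω n k u
  have := (ENNReal.tendsto_ofReal h).liminf_eq
  rw [XX, this, ENNReal.toReal_ofReal h0]

theorem Good.tendsto (hσ0 : 0 < σm) {s : ℝ} {ω : Omega d m σm σp} (h : Good s ω) (k : ℕ)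
    (u : Fin k → Fin m) : Tendsto (fun n => MM s ω n k u) atTop (𝓝 (XX s ω k u)) := by
  obtain ⟨x, hx⟩ := h k u
  rwa [XX_eq hσ0 hx]

theorem Good.XX_sum (hσ0 : 0 < σm) {s : ℝ} {ω : Omega d m σm σp} (h : Good s ω) (k : ℕ)
    (u : Fin k → Fin m) :
    XX s ω k u = ∑ a : Fin m, rs s ω ⟨k, sn u a⟩ * XX s ω (k+1) (sn u a) := by
  apply XX_eq hσ0
  rw [← tendsto_add_atTop_iff_nat 1]
  exact tendsto_finsetSum _ fun a _ => (h.tendsto hσ0 (k+1) (sn u a)).const_mul _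

theorem good_of_deep {s : ℝ} {ω : Omega d m σm σp} (N : ℕ)
    (h : ∀ k, N ≤ k → ∀ u : Fin k → Fin m, ∃ x, Tendsto (fun n => MM s ω n k u) atTop (𝓝 x)) :
    Good s ω := by
  induction N with
  | zero => exact fun k u => h k (Nat.zero_le _) u
  | succ N ih =>
    apply ih
    intro k hk u
    rcases hk.eq_or_lt with rfl | hk
    · choose x hx using fun a => h (N+1) le_rfl (sn u a)
      refine ⟨∑ a, rs s ω ⟨N, sn u a⟩ * x a, ?_⟩
      rw [← tendsto_add_atTop_iff_nat 1]
      exact tendsto_finsetSum _ fun a _ => (hx a).const_mul _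
    · exact h k hk u

/-- nodes strictly extending `u` -/
def Below {m k : ℕ} (u : Fin k → Fin m) : Set (JW m) :=
  {v | ∃ h : k ≤ v.1, ∀ t : Fin k, v.2 ⟨t.1, by omega⟩ = u t}

theorem below_sn {m k : ℕ} (u : Fin k → Fin m) (a : Fin m) : Below (sn u a) ⊆ Below u := by
  rintro v ⟨h, hv⟩
  refine ⟨by omega, fun t => ?_⟩
  have := hv t.castSucc
  simpa [sn] using this

theorem node_below {m k : ℕ} (u : Fin k → Fin m) (a : Fin m) :
    (⟨k, sn u a⟩ : JW m) ∈ Below u := by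
  refine ⟨le_rfl, fun t => ?_⟩
  exact Fin.snoc_castSucc (α := fun _ => Fin m) a u t

theorem MM_congr {s : ℝ} {ω ω' : Omega d m σm σp} (n k : ℕ) (u : Fin k → Fin m)
    (h : ∀ v ∈ Below u, ω v = ω' v) : MM s ω n k u = MM s ω' n k u := by
  induction n generalizing k with
  | zero => rfl
  | succ n ih =>
    refine Finset.sum_congr rfl fun a _ => ?_
    rw [ih _ _ fun v hv => h v (below_sn u a hv), rs, rs, h _ (node_below u a)]

theorem XX_congr {s : ℝ} {ω ω' : Omega d m σm σp} (k : ℕ) (u : Fin k → Fin m)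
    (h : ∀ v ∈ Below u, ω v = ω' v) : XX s ω k u = XX s ω' k u := by
  simp only [XX, MM_congr _ k u h]

theorem good_congr {s : ℝ} {ω ω' : Omega d m σm σp} {w₀ : JW m}
    (h : ∀ w : JW m, w ≠ w₀ → ω w = ω' w) (hg : Good s ω) : Good s ω' := by
  refine good_of_deep (w₀.1+1) fun k hk u => ?_
  obtain ⟨x, hx⟩ := hg k u
  refine ⟨x, hx.congr fun n => MM_congr n k u fun v hv => h v ?_⟩
  rintro rfl
  obtain ⟨h1, -⟩ := hv
  omega

theorem wordR_pos (hσ0 : 0 < σm) (ω : Omega d m σm σp) {k : ℕ} (u : Fin k → Fin m) :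
    0 < wordR ω u := Finset.prod_pos fun _ _ => lab_pos hσ0 ω _

theorem wordR_sn (ω : Omega d m σm σp) {k : ℕ} (u : Fin k → Fin m) (a : Fin m) :
    wordR ω (sn u a) = wordR ω u * ((ω ⟨k, sn u a⟩).1 : ℝ) := by
  rw [wordR, Fin.prod_univ_castSucc]
  congr 1
  refine Finset.prod_congr rfl fun j _ => ?_
  congr 4
  funext t
  exact Fin.snoc_castSucc (α := fun _ => Fin m) a u (Fin.castLE j.2 t)

theorem exists_mu (hm : 2 ≤ m) (hσ0 : 0 < σm) (s : ℝ) :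
    ∃ μ : Omega d m σm σp → Measure (ℕ → Fin m), (∀ ω, IsFiniteMeasure (μ ω)) ∧
      (∀ ω, Good s ω → ∀ k (u : Fin k → Fin m),
        μ ω (cyl u) = ENNReal.ofReal (wordR ω u ^ s * XX s ω k u)) ∧
      (∀ ω, ¬ Good s ω → μ ω = 0) := by
  classical
  have : NeZero m := ⟨by omega⟩
  have key : ∀ ω : Omega d m σm σp, ∃ μ : Measure (ℕ → Fin m), IsFiniteMeasure μ ∧
      (Good s ω → ∀ k (u : Fin k → Fin m),
        μ (cyl u) = ENNReal.ofReal (wordR ω u ^ s * XX s ω k u)) ∧ (¬ Good s ω → μ = 0) := by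
    intro ω
    by_cases hg : Good s ω
    · obtain ⟨μ, h1, h2⟩ := exists_measure (m := m)
        (fun k u => (wordR ω u ^ s * XX s ω k u).toNNReal) (by
          intro k u
          have hnn : ∀ k (u : Fin k → Fin m), 0 ≤ wordR ω u ^ s * XX s ω k u := fun k u =>
            mul_nonneg (Real.rpow_pos_of_pos (wordR_pos hσ0 ω u) s).le (XX_nonneg s ω k u)
          rw [← Real.toNNReal_sum_of_nonneg fun a _ => hnn _ _, hg.XX_sum hσ0, Finset.mul_sum]
          congr 1
          refine Finset.sum_congr rfl fun a _ => ?_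
          rw [wordR_sn, Real.mul_rpow (wordR_pos hσ0 ω u).le (lab_pos hσ0 ω _).le, rs, mul_assoc])
      exact ⟨μ, h1, fun _ k u => h2 k u, fun h => absurd hg h⟩
    · exact ⟨0, inferInstance, fun h => absurd h hg, fun _ => rfl⟩
  choose μ h1 h2 h3 using key
  exact ⟨μ, h1, h2, h3⟩

theorem cov1 (hσ0 : 0 < σm) (s : ℝ) (ω ω' : Omega d m σm σp) (w₀ : JW m)
    (h : ∀ w : JW m, w ≠ w₀ → ω w = ω' w) (n : ℕ) (v : Fin n → Fin m) (hn : w₀.1 + 1 ≤ n)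
    (hv : wmatch v w₀.2) :
    wordR ω v ^ s * XX s ω n v =
      ((((ω w₀).1 : ℝ) / ((ω' w₀).1 : ℝ)) ^ s) * (wordR ω' v ^ s * XX s ω' n v) := by
  have hX : XX s ω n v = XX s ω' n v := by
    refine XX_congr n v fun x hx => h x ?_
    rintro rfl
    obtain ⟨h1, -⟩ := hx
    omega
  have hR : wordR ω v = ((ω w₀).1 : ℝ) / ((ω' w₀).1 : ℝ) * wordR ω' v := by
    obtain ⟨k, w⟩ := w₀
    have hk : k < n := hn
    rw [wordR, wordR, ← Finset.mul_prod_erase _ _ (Finset.mem_univ (⟨k, hk⟩ : Fin n)),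
      ← Finset.mul_prod_erase _ _ (Finset.mem_univ (⟨k, hk⟩ : Fin n))]
    have e : (⟨k, fun t => v (Fin.castLE hk t)⟩ : JW m) = ⟨k, w⟩ := by
      congr 1
      funext t
      exact hv t _
    simp only [e]
    have hp := lab_pos hσ0 ω' ⟨k, w⟩
    rw [← mul_assoc, div_mul_cancel₀ _ hp.ne']
    congr 1
    refine Finset.prod_congr rfl fun j hj => ?_
    rw [h]
    intro he
    apply Finset.ne_of_mem_erase hj
    exact Fin.ext (congrArg Sigma.fst he)
  rw [hX, hR, Real.mul_rpow (div_pos (lab_pos hσ0 ω _) (lab_pos hσ0 ω' _)).le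
    (wordR_pos hσ0 ω' v).le, mul_assoc]

theorem cov2 (s : ℝ) (ω ω' : Omega d m σm σp) (w₀ w₁ : JW m)
    (h : ∀ w : JW m, w ≠ w₀ → ω w = ω' w) (h01 : ¬ isPrefix w₀ w₁) (h10 : ¬ isPrefix w₁ w₀)
    (n : ℕ) (v : Fin n → Fin m) (hn : w₁.1 + 1 ≤ n) (hv : wmatch v w₁.2) :
    wordR ω v ^ s * XX s ω n v = wordR ω' v ^ s * XX s ω' n v := by
  have hX : XX s ω n v = XX s ω' n v := by
    refine XX_congr n v fun x hx => h x ?_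
    rintro rfl
    obtain ⟨h1, h2⟩ := hx
    refine h10 ⟨by omega, fun t => ?_⟩
    rw [← hv t (by omega)]
    exact h2 ⟨t, by omega⟩
  have hR : wordR ω v = wordR ω' v := by
    refine Finset.prod_congr rfl fun j _ => ?_
    rw [h]
    rintro rfl
    rcases le_total w₁.1 j.1 with hj | hj
    · exact h10 ⟨hj, fun t => hv t (by omega)⟩
    · exact h01 ⟨hj, fun t => (hv ⟨t.1, by dsimp at *; omega⟩ (by dsimp at *; omega)).symm⟩
  rw [hX, hR]

theorem cov_measure (hσ0 : 0 < σm) (s : ℝ) (μ : Omega d m σm σp → Measure (ℕ → Fin m))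
    (h1 : ∀ ω, IsFiniteMeasure (μ ω))
    (h2 : ∀ ω, Good s ω → ∀ k (u : Fin k → Fin m),
        μ ω (cyl u) = ENNReal.ofReal (wordR ω u ^ s * XX s ω k u))
    (h3 : ∀ ω, ¬ Good s ω → μ ω = 0)
    (ω ω' : Omega d m σm σp) (w₀ : JW m) (h : ∀ w : JW m, w ≠ w₀ → ω w = ω' w) :
    ((μ ω).restrict (cylNode w₀) =
          ENNReal.ofReal ((((ω w₀).1 : ℝ) / ((ω' w₀).1 : ℝ)) ^ s) •
            (μ ω').restrict (cylNode w₀)) ∧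
        ∀ w₁ : JW m, ¬ isPrefix w₀ w₁ → ¬ isPrefix w₁ w₀ →
          (μ ω).restrict (cylNode w₁) = (μ ω').restrict (cylNode w₁) := by
  have h' : ∀ w : JW m, w ≠ w₀ → ω' w = ω w := fun w hw => (h w hw).symm
  by_cases hg : Good s ω
  · have hg' : Good s ω' := good_congr h hg
    constructor
    · rw [← Measure.restrict_smul]
      refine measure_ext_cyl _ _ w₀.2 fun n v hn hv => ?_
      rw [h2 ω hg, Measure.smul_apply, h2 ω' hg', cov1 hσ0 s ω ω' w₀ h n v hn hv,
        ENNReal.ofReal_mul, smul_eq_mul]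
      exact (Real.rpow_pos_of_pos (div_pos (lab_pos hσ0 ω _) (lab_pos hσ0 ω' _)) s).le
    · intro w₁ h01 h10
      refine measure_ext_cyl _ _ w₁.2 fun n v hn hv => ?_
      rw [h2 ω hg, h2 ω' hg', cov2 s ω ω' w₀ w₁ h h01 h10 n v hn hv]
  · have hg' : ¬ Good s ω' := fun hh => hg (good_congr h' hh)
    rw [h3 ω hg, h3 ω' hg']
    simp
end Det
section Prob
open ProbabilityTheory
variable {d m : ℕ} {σm σp : ℝ}

@[reducible] def GS (d m : ℕ) (σm σp : ℝ) (S : Set (JW m)) : MeasurableSpace (Omega d m σm σp) :=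
  ⨆ v ∈ S, MeasurableSpace.comap (fun ω => ω v) inferInstance

theorem GS_le (S : Set (JW m)) : GS d m σm σp S ≤ MeasurableSpace.pi :=
  iSup₂_le fun v _ => (measurable_pi_apply v).comap_le

theorem Fk_eq (k : ℕ) : Fk d m σm σp k = GS d m σm σp {v | v.1 + 1 ≤ k} := by
  rw [Fk, GS, iSup_subtype']
  rfl

theorem coord_law {θ : Measure (Od d)} {P : Measure (Omega d m σm σp)} (hP2 : IsProductLaw θ P)
    (v : JW m) (A : Set (Label d σm σp)) (hA : MeasurableSet A) :
    P ((fun ω => ω v) ⁻¹' A) = labelM σm σp θ A := by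
  have := hP2 {v} (fun _ => A) fun _ => hA
  simp only [Finset.mem_singleton, forall_eq, Finset.prod_singleton] at this
  exact this

theorem coord_indep {θ : Measure (Od d)} {P : Measure (Omega d m σm σp)}
    (hP2 : IsProductLaw θ P) :
    iIndep (fun v : JW m => MeasurableSpace.comap (fun ω : Omega d m σm σp => ω v) inferInstance)
      P := by
  classical
  refine iIndepFun.iIndep (f := fun (v : JW m) (ω : Omega d m σm σp) => ω v) ?_
  rw [iIndepFun_iff_measure_inter_preimage_eq_mul]
  intro S A hA
  have h := hP2 S (fun v => if v ∈ S then A v else Set.univ) (fun v => by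
    split_ifs with hv
    · exact hA v hv
    · exact MeasurableSet.univ)
  have e1 : (⋂ i ∈ S, (fun ω : Omega d m σm σp => ω i) ⁻¹' A i) =
      {ω | ∀ w ∈ S, ω w ∈ (if w ∈ S then A w else Set.univ)} := by
    ext ω
    simp only [Set.mem_iInter, Set.mem_preimage, Set.mem_ofPred_eq]
    refine forall₂_congr fun w hw => ?_
    rw [if_pos hw]
  rw [e1, h]
  refine Finset.prod_congr rfl fun v hv => ?_
  rw [if_pos hv, coord_law hP2 v _ (hA v hv)]

theorem GS_indep {θ : Measure (Od d)} {P : Measure (Omega d m σm σp)} (hP2 : IsProductLaw θ P)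
    {S T : Set (JW m)} (h : Disjoint S T) : Indep (GS d m σm σp S) (GS d m σm σp T) P :=
  indep_iSup_of_disjoint (fun v => (measurable_pi_apply v).comap_le) (coord_indep hP2) h

theorem int_mul {θ : Measure (Od d)} {P : Measure (Omega d m σm σp)} (hP2 : IsProductLaw θ P)
    {S T : Set (JW m)} (h : Disjoint S T) {f g : Omega d m σm σp → ℝ}
    (hf : Measurable[GS d m σm σp S] f) (hg : Measurable[GS d m σm σp T] g) :
    ∫ ω, f ω * g ω ∂P = (∫ ω, f ω ∂P) * ∫ ω, g ω ∂P := by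
  apply IndepFun.integral_fun_mul_eq_mul_integral
  · rw [IndepFun_iff_Indep]
    exact indep_of_indep_of_le_right (indep_of_indep_of_le_left (GS_indep hP2 h) hf.comap_le)
      hg.comap_le
  · exact (hf.mono (GS_le S) le_rfl).aestronglyMeasurable
  · exact (hg.mono (GS_le T) le_rfl).aestronglyMeasurable

theorem rs_meas (s : ℝ) {S : Set (JW m)} {v : JW m} (hv : v ∈ S) :
    Measurable[GS d m σm σp S] (fun ω => rs s ω v) := by
  have h1 : Measurable[MeasurableSpace.comap (fun ω : Omega d m σm σp => ω v) inferInstance]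
      (fun ω : Omega d m σm σp => ω v) := comap_measurable _
  have h2 : Measurable (fun l : Label d σm σp => (l.1 : ℝ) ^ s) :=
    (measurable_subtype_coe.comp measurable_fst).pow_const s
  exact (h2.comp h1).mono (le_iSup₂_of_le v hv le_rfl) le_rfl

theorem MM_meas (s : ℝ) {S : Set (JW m)} (n k : ℕ) (u : Fin k → Fin m)
    (h : ∀ v ∈ Below u, v.1 < k + n → v ∈ S) :
    Measurable[GS d m σm σp S] (fun ω => MM s ω n k u) := by
  induction n generalizing k with
  | zero => exact measurable_const
  | succ n ih =>
    simp only [MM]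
    refine Finset.measurable_fun_sum _ fun a _ => Measurable.mul ?_ ?_
    · exact rs_meas s (h _ (node_below u a) (by dsimp; omega))
    · exact ih _ _ fun v hv hv' => h v (below_sn u a hv) (by omega)

theorem MM_meas' (s : ℝ) (n k : ℕ) (u : Fin k → Fin m) :
    Measurable (fun ω : Omega d m σm σp => MM s ω n k u) :=
  (MM_meas s (S := Set.univ) n k u fun _ _ _ => trivial).mono (GS_le _) le_rfl

theorem rs_meas' (s : ℝ) (v : JW m) :
    Measurable (fun ω : Omega d m σm σp => rs s ω v) :=
  (rs_meas s (S := Set.univ) trivial).mono (GS_le _) le_rfl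

theorem XX_meas (s : ℝ) {S : Set (JW m)} (k : ℕ) (u : Fin k → Fin m) (h : Below u ⊆ S) :
    Measurable[GS d m σm σp S] (fun ω => XX s ω k u) := by
  refine Measurable.ennreal_toReal ?_
  exact Measurable.liminf fun n => (MM_meas s n k u fun v hv _ => h hv).ennreal_ofReal

theorem XX_meas' (s : ℝ) (k : ℕ) (u : Fin k → Fin m) :
    Measurable (fun ω : Omega d m σm σp => XX s ω k u) :=
  (XX_meas s (S := Set.univ) k u fun _ _ => trivial).mono (GS_le _) le_rfl

theorem good_meas (s : ℝ) : MeasurableSet {ω : Omega d m σm σp | Good s ω} := by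
  have : {ω : Omega d m σm σp | Good s ω} = ⋂ k, ⋂ u : Fin k → Fin m,
      {ω | ∃ x, Tendsto (fun n => MM s ω n k u) atTop (𝓝 x)} := by
    ext ω; simp [Good]
  rw [this]
  exact MeasurableSet.iInter fun k => MeasurableSet.iInter fun u =>
    measurableSet_exists_tendsto fun n => MM_meas' s n k u

theorem rs_le (hσ0 : 0 < σm) {s : ℝ} (hs0 : 0 < s) (ω : Omega d m σm σp) (v : JW m) :
    rs s ω v ≤ σp ^ s :=
  Real.rpow_le_rpow (lab_pos hσ0 ω v).le (ω v).1.2.2.le hs0.le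

theorem rs_le_one (hσ0 : 0 < σm) (hσ2 : σp < 1) {s : ℝ} (hs0 : 0 < s)
    (ω : Omega d m σm σp) (v : JW m) : rs s ω v ≤ 1 :=
  Real.rpow_le_one (lab_pos hσ0 ω v).le ((ω v).1.2.2.le.trans hσ2.le) hs0.le

theorem MM_le (hσ0 : 0 < σm) (hσ2 : σp < 1) {s : ℝ} (hs0 : 0 < s)
    (ω : Omega d m σm σp) (n k : ℕ) (u : Fin k → Fin m) : MM s ω n k u ≤ (m : ℝ) ^ n := by
  induction n generalizing k with
  | zero => simp [MM]
  | succ n ih =>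
    calc MM s ω (n+1) k u ≤ ∑ a : Fin m, (m : ℝ) ^ n := by
          refine Finset.sum_le_sum fun a _ => ?_
          have h1 := rs_le_one hσ0 hσ2 hs0 ω ⟨k, sn u a⟩
          have h2 := (rs_pos hσ0 s ω ⟨k, sn u a⟩).le
          have h3 := ih (k+1) (sn u a)
          have h4 := MM_nonneg hσ0 s ω n (k+1) (sn u a)
          nlinarith
      _ = _ := by simp [pow_succ, mul_comm]

theorem rs_int {θ : Measure (Od d)} [IsProbabilityMeasure θ] {P : Measure (Omega d m σm σp)}
    (hP2 : IsProductLaw θ P) (hm : 2 ≤ m) (hσ1 : σm ≤ σp) {s : ℝ}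
    (hs : ((m : ℝ) / (σp - σm)) * (∫ r in σm..σp, r ^ s) = 1) (v : JW m) :
    ∫ ω, rs s ω v ∂P = 1 / m := by
  have hlt : 0 < σp - σm := by
    rcases hσ1.eq_or_lt with h | h
    · subst h; simp at hs
    · linarith
  have hmap : P.map (fun ω => ω v) = labelM σm σp θ := by
    refine Measure.ext fun A hA => ?_
    rw [Measure.map_apply (measurable_pi_apply v) hA, coord_law hP2 v A hA]
  have h2 : Measurable (fun l : Label d σm σp => (l.1 : ℝ) ^ s) :=
    (measurable_subtype_coe.comp measurable_fst).pow_const s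
  have h3 := integral_map (μ := P) (measurable_pi_apply v).aemeasurable
    (f := fun l : Label d σm σp => (l.1 : ℝ) ^ s) h2.aestronglyMeasurable
  have : IsFiniteMeasure (Measure.comap (Subtype.val : Set.Ioo σm σp → ℝ) volume) := by
    constructor
    rw [(MeasurableEmbedding.subtype_coe measurableSet_Ioo).comap_apply, Set.image_univ,
      Subtype.range_coe, Real.volume_Ioo]
    exact ENNReal.ofReal_lt_top
  have hsf : SFinite (unifSub σm σp) := by unfold unifSub; infer_instance
  unfold rs
  rw [← h3, hmap, labelM, integral_fun_fst (fun x : Set.Ioo σm σp => (x : ℝ) ^ s), unifSub,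
    integral_smul_measure, integral_subtype_comap measurableSet_Ioo (fun x : ℝ => x ^ s),
    ← integral_Ioc_eq_integral_Ioo, ← intervalIntegral.integral_of_le hσ1]
  simp only [probReal_univ, smul_eq_mul, one_mul, ENNReal.toReal_inv,
    ENNReal.toReal_ofReal hlt.le]
  have hm0 : (m : ℝ) ≠ 0 := by positivity
  field_simp at hs ⊢
  linarith

end Prob
section Prob2
open ProbabilityTheory
variable {d m : ℕ} {σm σp : ℝ}

/-- nodes whose letter at position `k` is `a` -/
def Ch (m k : ℕ) (a : Fin m) : Set (JW m) := {v | ∃ h : k ≤ v.1, v.2 ⟨k, by omega⟩ = a}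

theorem Ch_disj {k : ℕ} {a b : Fin m} (h : a ≠ b) : Disjoint (Ch m k a) (Ch m k b) := by
  rw [Set.disjoint_left]
  rintro v ⟨_, h1⟩ ⟨_, h2⟩
  exact h (h1.symm.trans h2)

theorem node_Ch {k : ℕ} (u : Fin k → Fin m) (a : Fin m) : (⟨k, sn u a⟩ : JW m) ∈ Ch m k a :=
  ⟨le_rfl, Fin.snoc_last (α := fun _ => Fin m) a u⟩

theorem below_Ch {k : ℕ} (u : Fin k → Fin m) (a : Fin m) : Below (sn u a) ⊆ Ch m k a := by
  rintro v ⟨h, hv⟩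
  refine ⟨by omega, ?_⟩
  have := hv (Fin.last k)
  simpa [sn] using this

theorem node_not_below {k : ℕ} (u : Fin k → Fin m) (a : Fin m) :
    Disjoint {(⟨k, sn u a⟩ : JW m)} (Below (sn u a)) := by
  rw [Set.disjoint_singleton_left]
  rintro ⟨h, -⟩
  dsimp at h
  omega

noncomputable def DD (s : ℝ) (ω : Omega d m σm σp) (n k : ℕ) (u : Fin k → Fin m) : ℝ :=
  MM s ω (n+1) k u - MM s ω n k u

theorem DD_succ (s : ℝ) (ω : Omega d m σm σp) (n k : ℕ) (u : Fin k → Fin m) :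
    DD s ω (n+1) k u = ∑ a : Fin m, rs s ω ⟨k, sn u a⟩ * DD s ω n (k+1) (sn u a) := by
  simp only [DD, mul_sub, Finset.sum_sub_distrib]
  rfl

theorem DD_meas (s : ℝ) {S : Set (JW m)} (n k : ℕ) (u : Fin k → Fin m) (h : Below u ⊆ S) :
    Measurable[GS d m σm σp S] (fun ω => DD s ω n k u) :=
  (MM_meas s (n+1) k u fun _ hv _ => h hv).sub (MM_meas s n k u fun _ hv _ => h hv)

theorem DD_meas' (s : ℝ) (n k : ℕ) (u : Fin k → Fin m) :
    Measurable (fun ω : Omega d m σm σp => DD s ω n k u) :=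
  (MM_meas' s (n+1) k u).sub (MM_meas' s n k u)

theorem DD_le (hσ0 : 0 < σm) (hσ2 : σp < 1) {s : ℝ} (hs0 : 0 < s)
    (ω : Omega d m σm σp) (n k : ℕ) (u : Fin k → Fin m) :
    |DD s ω n k u| ≤ (m : ℝ) ^ (n+1) + (m : ℝ) ^ n := by
  have h1 := MM_nonneg hσ0 s ω n k u
  have h2 := MM_nonneg hσ0 s ω (n+1) k u
  have h3 := MM_le hσ0 hσ2 hs0 ω n k u
  have h4 := MM_le hσ0 hσ2 hs0 ω (n+1) k u
  rw [DD, abs_le]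
  constructor <;> linarith

theorem bdd_int {P : Measure (Omega d m σm σp)} [IsProbabilityMeasure P]
    {f : Omega d m σm σp → ℝ} (hf : Measurable f) (C : ℝ) (h : ∀ ω, |f ω| ≤ C) :
    Integrable f P :=
  Integrable.of_bound hf.aestronglyMeasurable C (Eventually.of_forall h)

theorem rsDD_le (hσ0 : 0 < σm) (hσ2 : σp < 1) {s : ℝ} (hs0 : 0 < s)
    (ω : Omega d m σm σp) (v : JW m) (n k : ℕ) (u : Fin k → Fin m) :
    |rs s ω v * DD s ω n k u| ≤ (m : ℝ) ^ (n+1) + (m : ℝ) ^ n := by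
  rw [abs_mul, abs_of_pos (rs_pos hσ0 s ω v)]
  have h1 := DD_le hσ0 hσ2 hs0 ω n k u
  have h2 := rs_le_one hσ0 hσ2 hs0 ω v
  have h3 := abs_nonneg (DD s ω n k u)
  nlinarith

variable {θ : Measure (Od d)} {P : Measure (Omega d m σm σp)} [IsProbabilityMeasure P]

theorem MM_integrable (hσ0 : 0 < σm) (hσ2 : σp < 1) {s : ℝ} (hs0 : 0 < s)
    (n k : ℕ) (u : Fin k → Fin m) : Integrable (fun ω => MM s ω n k u) P :=
  bdd_int (MM_meas' s n k u) _ fun ω => by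
    rw [abs_of_nonneg (MM_nonneg hσ0 s ω n k u)]
    exact MM_le hσ0 hσ2 hs0 ω n k u

theorem DD_integrable (hσ0 : 0 < σm) (hσ2 : σp < 1) {s : ℝ} (hs0 : 0 < s)
    (n k : ℕ) (u : Fin k → Fin m) : Integrable (fun ω => DD s ω n k u) P :=
  bdd_int (DD_meas' s n k u) _ fun ω => DD_le hσ0 hσ2 hs0 ω n k u

theorem DD2_integrable (hσ0 : 0 < σm) (hσ2 : σp < 1) {s : ℝ} (hs0 : 0 < s)
    (n k : ℕ) (u : Fin k → Fin m) : Integrable (fun ω => DD s ω n k u ^ 2) P :=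
  bdd_int ((DD_meas' s n k u).pow_const 2) (((m : ℝ) ^ (n+1) + (m : ℝ) ^ n)^2) fun ω => by
    rw [abs_pow]
    exact pow_le_pow_left₀ (abs_nonneg _) (DD_le hσ0 hσ2 hs0 ω n k u) 2

theorem MM_int (hP2 : IsProductLaw θ P) (hm : 2 ≤ m) (hσ0 : 0 < σm) (hσ2 : σp < 1) {s : ℝ}
    (hs0 : 0 < s) (hr : ∀ v : JW m, ∫ ω, rs s ω v ∂P = 1 / m) (n k : ℕ) (u : Fin k → Fin m) :
    ∫ ω, MM s ω n k u ∂P = 1 := by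
  induction n generalizing k with
  | zero => simp [MM]
  | succ n ih =>
    simp only [MM]
    rw [integral_finsetSum]
    · have : ∀ a : Fin m, ∫ ω, rs s ω ⟨k, sn u a⟩ * MM s ω n (k+1) (sn u a) ∂P = 1 / m := by
        intro a
        rw [int_mul hP2 (node_not_below u a) (rs_meas s rfl) (MM_meas s _ _ _ fun v hv _ => hv),
          ih, hr, mul_one]
      simp only [this]
      have hm0 : (m : ℝ) ≠ 0 := by positivity
      simp [hm0]
    · intro a _
      refine (MM_integrable hσ0 hσ2 hs0 n (k+1) (sn u a)).bdd_mul (c := 1)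
        (rs_meas' s _).aestronglyMeasurable (Eventually.of_forall fun ω => ?_)
      rw [Real.norm_eq_abs, abs_of_pos (rs_pos hσ0 s ω _)]
      exact rs_le_one hσ0 hσ2 hs0 ω _

theorem DD_int (hP2 : IsProductLaw θ P) (hm : 2 ≤ m) (hσ0 : 0 < σm) (hσ2 : σp < 1) {s : ℝ}
    (hs0 : 0 < s) (hr : ∀ v : JW m, ∫ ω, rs s ω v ∂P = 1 / m) (n k : ℕ) (u : Fin k → Fin m) :
    ∫ ω, DD s ω n k u ∂P = 0 := by
  unfold DD
  rw [integral_sub (MM_integrable hσ0 hσ2 hs0 _ k u) (MM_integrable hσ0 hσ2 hs0 _ k u),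
    MM_int hP2 hm hσ0 hσ2 hs0 hr, MM_int hP2 hm hσ0 hσ2 hs0 hr, sub_self]

theorem DD2_int (hP2 : IsProductLaw θ P) (hm : 2 ≤ m) (hσ0 : 0 < σm) (hσp : 0 < σp)
    (hσ2 : σp < 1) {s : ℝ}
    (hs0 : 0 < s) (hr : ∀ v : JW m, ∫ ω, rs s ω v ∂P = 1 / m) (n k : ℕ) (u : Fin k → Fin m) :
    ∫ ω, DD s ω n k u ^ 2 ∂P ≤ (m : ℝ) ^ 2 * (σp ^ s) ^ n := by
  have hm0 : (0 : ℝ) < m := by positivity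
  have hq : 0 < σp ^ s := Real.rpow_pos_of_pos hσp s
  induction n generalizing k with
  | zero =>
    have : ∀ ω : Omega d m σm σp, DD s ω 0 k u ^ 2 ≤ (m : ℝ) ^ 2 := by
      intro ω
      have h0 : DD s ω 0 k u = ∑ a : Fin m, rs s ω ⟨k, sn u a⟩ - 1 := by simp [DD, MM]
      have h1 : 0 ≤ ∑ a : Fin m, rs s ω ⟨k, sn u a⟩ :=
        Finset.sum_nonneg fun a _ => (rs_pos hσ0 s ω _).le
      have h2 : ∑ a : Fin m, rs s ω ⟨k, sn u a⟩ ≤ m := by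
        calc _ ≤ ∑ a : Fin m, (1 : ℝ) := Finset.sum_le_sum fun a _ => rs_le_one hσ0 hσ2 hs0 ω _
          _ = m := by simp
      have h3 : (2 : ℝ) ≤ m := by exact_mod_cast hm
      rw [h0]
      apply sq_le_sq'  <;> linarith
    calc _ ≤ ∫ ω, (m : ℝ) ^ 2 ∂P :=
          integral_mono (DD2_integrable hσ0 hσ2 hs0 0 k u) (integrable_const _) this
      _ = _ := by simp
  | succ n ih =>
    have e : ∀ ω : Omega d m σm σp, DD s ω (n+1) k u ^ 2 = ∑ a : Fin m, ∑ b : Fin m,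
        (rs s ω ⟨k, sn u a⟩ * DD s ω n (k+1) (sn u a)) *
          (rs s ω ⟨k, sn u b⟩ * DD s ω n (k+1) (sn u b)) := by
      intro ω
      rw [DD_succ, sq, Finset.sum_mul_sum]
    have hI : ∀ a b : Fin m, Integrable (fun ω => (rs s ω ⟨k, sn u a⟩ * DD s ω n (k+1) (sn u a)) *
          (rs s ω ⟨k, sn u b⟩ * DD s ω n (k+1) (sn u b))) P := by
      intro a b
      refine bdd_int (((rs_meas' s _).mul (DD_meas' s _ _ _)).mul
        ((rs_meas' s _).mul (DD_meas' s _ _ _))) (((m : ℝ) ^ (n+1) + (m : ℝ) ^ n) *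
          ((m : ℝ) ^ (n+1) + (m : ℝ) ^ n)) fun ω => ?_
      rw [abs_mul]
      exact mul_le_mul (rsDD_le hσ0 hσ2 hs0 ω _ _ _ _) (rsDD_le hσ0 hσ2 hs0 ω _ _ _ _)
        (abs_nonneg _) (by positivity)
    have hmean : ∀ a : Fin m, ∫ ω, rs s ω ⟨k, sn u a⟩ * DD s ω n (k+1) (sn u a) ∂P = 0 := by
      intro a
      rw [int_mul hP2 (node_not_below u a) (rs_meas s rfl) (DD_meas s _ _ _ subset_rfl),
        DD_int hP2 hm hσ0 hσ2 hs0 hr, mul_zero]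
    have hme : ∀ a : Fin m, Measurable[GS d m σm σp (Ch m k a)]
        (fun ω => rs s ω ⟨k, sn u a⟩ * DD s ω n (k+1) (sn u a)) := fun a =>
      (rs_meas s (node_Ch u a)).mul (DD_meas s _ _ _ (below_Ch u a))
    have hdiag : ∀ a : Fin m, ∫ ω, (rs s ω ⟨k, sn u a⟩ * DD s ω n (k+1) (sn u a)) *
          (rs s ω ⟨k, sn u a⟩ * DD s ω n (k+1) (sn u a)) ∂P ≤
            σp ^ s * (1 / m * ((m : ℝ) ^ 2 * (σp ^ s) ^ n)) := by
      intro a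
      calc _ ≤ ∫ ω, σp ^ s * (rs s ω ⟨k, sn u a⟩ * DD s ω n (k+1) (sn u a) ^ 2) ∂P := by
            refine integral_mono (hI a a) ?_ fun ω => ?_
            · refine Integrable.const_mul ?_ _
              refine (DD2_integrable hσ0 hσ2 hs0 n (k+1) (sn u a)).bdd_mul (c := 1)
                (rs_meas' s _).aestronglyMeasurable (Eventually.of_forall fun ω => ?_)
              rw [Real.norm_eq_abs, abs_of_pos (rs_pos hσ0 s ω _)]
              exact rs_le_one hσ0 hσ2 hs0 ω _
            · dsimp only
              have h1 := rs_le hσ0 hs0 ω ⟨k, sn u a⟩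
              have h2 : 0 ≤ rs s ω ⟨k, sn u a⟩ * DD s ω n (k+1) (sn u a) ^ 2 :=
                mul_nonneg (rs_pos hσ0 s ω _).le (sq_nonneg _)
              calc _ = rs s ω ⟨k, sn u a⟩ *
                    (rs s ω ⟨k, sn u a⟩ * DD s ω n (k+1) (sn u a) ^ 2) := by ring
                _ ≤ _ := mul_le_mul_of_nonneg_right h1 h2
        _ = σp ^ s * (1 / m * ∫ ω, DD s ω n (k+1) (sn u a) ^ 2 ∂P) := by
            rw [integral_const_mul, int_mul hP2 (node_not_below u a) (rs_meas s rfl)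
              ((DD_meas s _ _ _ subset_rfl).pow_const 2), hr]
        _ ≤ _ := by
            have := ih (k+1) (sn u a)
            gcongr
    simp only [e]
    rw [integral_finsetSum _ fun a _ => integrable_finsetSum _ fun b _ => hI a b]
    have hrow : ∀ a : Fin m, ∫ ω, ∑ b : Fin m, (rs s ω ⟨k, sn u a⟩ * DD s ω n (k+1) (sn u a)) *
          (rs s ω ⟨k, sn u b⟩ * DD s ω n (k+1) (sn u b)) ∂P ≤
            σp ^ s * (1 / m * ((m : ℝ) ^ 2 * (σp ^ s) ^ n)) := by
      intro a
      rw [integral_finsetSum _ fun b _ => hI a b, Finset.sum_eq_single a]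
      · exact hdiag a
      · intro b _ hb
        rw [int_mul hP2 (Ch_disj hb.symm) (hme a) (hme b), hmean, zero_mul]
      · simp
    calc _ ≤ ∑ a : Fin m, σp ^ s * (1 / m * ((m : ℝ) ^ 2 * (σp ^ s) ^ n)) :=
          Finset.sum_le_sum fun a _ => hrow a
      _ = _ := by
        rw [Finset.sum_const, Finset.card_univ, Fintype.card_fin, nsmul_eq_mul, pow_succ (σp ^ s)]
        field_simp

theorem DD1_int (hP2 : IsProductLaw θ P) (hm : 2 ≤ m) (hσ0 : 0 < σm) (hσp : 0 < σp)
    (hσ2 : σp < 1) {s : ℝ}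
    (hs0 : 0 < s) (hr : ∀ v : JW m, ∫ ω, rs s ω v ∂P = 1 / m) (n k : ℕ) (u : Fin k → Fin m) :
    ∫ ω, |DD s ω n k u| ∂P ≤ (m : ℝ) ^ 2 * (√(σp ^ s)) ^ n := by
  have hq : 0 < σp ^ s := Real.rpow_pos_of_pos hσp s
  set ρ := √(σp ^ s) with hρ
  have hρ0 : 0 < ρ := Real.sqrt_pos.2 hq
  have hρ2 : σp ^ s = ρ ^ 2 := (Real.sq_sqrt hq.le).symm
  have ht : 0 < ρ ^ n := pow_pos hρ0 n
  have h2 := DD2_int hP2 hm hσ0 hσp hσ2 hs0 hr n k u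
  have e : (σp ^ s) ^ n = ρ ^ n * ρ ^ n := by rw [hρ2]; ring
  rw [e] at h2
  calc _ ≤ ∫ ω, (DD s ω n k u ^ 2 * (2 * ρ ^ n)⁻¹ + ρ ^ n / 2) ∂P := by
        refine integral_mono (DD_integrable hσ0 hσ2 hs0 n k u).abs
          (((DD2_integrable hσ0 hσ2 hs0 n k u).mul_const _).add (integrable_const _)) fun ω => ?_
        dsimp only
        rw [← sq_abs (DD s ω n k u)]
        have : 0 ≤ (|DD s ω n k u| - ρ ^ n) ^ 2 * (2 * ρ ^ n)⁻¹ := by positivity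
        have e2 : (|DD s ω n k u| - ρ ^ n) ^ 2 * (2 * ρ ^ n)⁻¹ =
          |DD s ω n k u| ^ 2 * (2 * ρ ^ n)⁻¹ + ρ ^ n / 2 - |DD s ω n k u| := by
          field_simp; ring
        linarith
    _ = (∫ ω, DD s ω n k u ^ 2 ∂P) * (2 * ρ ^ n)⁻¹ + ρ ^ n / 2 := by
        rw [integral_add ((DD2_integrable hσ0 hσ2 hs0 n k u).mul_const _) (integrable_const _),
          integral_mul_const]
        simp
    _ ≤ ((m : ℝ) ^ 2 * (ρ ^ n * ρ ^ n)) * (2 * ρ ^ n)⁻¹ + ρ ^ n / 2 := by gcongr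
    _ = ((m : ℝ) ^ 2 + 1) / 2 * ρ ^ n := by field_simp
    _ ≤ _ := by
        have h3 : (2 : ℝ) ≤ m := by exact_mod_cast hm
        gcongr
        nlinarith

end Prob2
section Prob3
open ProbabilityTheory
variable {d m : ℕ} {σm σp : ℝ}

theorem ae_summable_aux {Ω : Type*} [MeasurableSpace Ω] {P : Measure Ω} {F : ℕ → Ω → ℝ}
    (hF : ∀ n, Integrable (F n) P) (h : Summable fun n => ∫ ω, ‖F n ω‖ ∂P) :
    ∀ᵐ ω ∂P, Summable fun n => F n ω := by
  have h1 : ∫⁻ ω, ∑' n, ‖F n ω‖ₑ ∂P ≠ ⊤ := by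
    rw [lintegral_tsum fun n => (hF n).1.enorm]
    simp only [← ofReal_integral_norm_eq_lintegral_enorm (hF _)]
    exact h.tsum_ofReal_ne_top
  have h2 := ae_lt_top' (AEMeasurable.ennreal_tsum fun n => (hF n).1.enorm) h1
  filter_upwards [h2] with ω hω
  have h3 := ENNReal.tsum_coe_ne_top_iff_summable.1 hω.ne
  exact Summable.of_norm (NNReal.summable_coe.2 h3)

noncomputable def FF (s : ℝ) (ω : Omega d m σm σp) (k : ℕ) (u : Fin k → Fin m) : ℕ → ℝ
  | 0 => 1
  | n+1 => DD s ω n k u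

theorem FF_sum (s : ℝ) (ω : Omega d m σm σp) (k : ℕ) (u : Fin k → Fin m) (n : ℕ) :
    ∑ i ∈ Finset.range (n+1), FF s ω k u i = MM s ω n k u := by
  induction n with
  | zero => simp [FF, MM]
  | succ n ih => rw [Finset.sum_range_succ, ih]; simp [FF, DD]

theorem FF_hasSum (s : ℝ) (ω : Omega d m σm σp) (k : ℕ) (u : Fin k → Fin m)
    (h : Summable (FF s ω k u)) :
    Tendsto (fun n => MM s ω n k u) atTop (𝓝 (∑' n, FF s ω k u n)) := by
  have := (tendsto_add_atTop_iff_nat 1).2 h.hasSum.tendsto_sum_nat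
  exact this.congr fun n => FF_sum s ω k u n

variable {θ : Measure (Od d)} {P : Measure (Omega d m σm σp)} [IsProbabilityMeasure P]

theorem FF_integrable (hσ0 : 0 < σm) (hσ2 : σp < 1) {s : ℝ} (hs0 : 0 < s)
    (k : ℕ) (u : Fin k → Fin m) (n : ℕ) : Integrable (fun ω => FF s ω k u n) P := by
  cases n with
  | zero => exact integrable_const _
  | succ n => exact DD_integrable hσ0 hσ2 hs0 n k u

theorem FF_summable (hP2 : IsProductLaw θ P) (hm : 2 ≤ m) (hσ0 : 0 < σm) (hσp : 0 < σp)
    (hσ2 : σp < 1) {s : ℝ}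
    (hs0 : 0 < s) (hr : ∀ v : JW m, ∫ ω, rs s ω v ∂P = 1 / m) (k : ℕ) (u : Fin k → Fin m) :
    Summable fun n => ∫ ω, ‖FF s ω k u n‖ ∂P := by
  rw [← summable_nat_add_iff 1]
  have hq : 0 < σp ^ s := Real.rpow_pos_of_pos hσp s
  have hq1 : σp ^ s < 1 := Real.rpow_lt_one hσp.le hσ2 hs0
  have hρ : √(σp ^ s) < 1 := by
    rw [Real.sqrt_lt' one_pos]; simpa using hq1
  refine Summable.of_nonneg_of_le (fun n => integral_nonneg fun ω => norm_nonneg _)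
    (fun n => DD1_int hP2 hm hσ0 hσp hσ2 hs0 hr n k u)
    ((summable_geometric_of_lt_one (Real.sqrt_nonneg _) hρ).mul_left _)

theorem ae_good (hP2 : IsProductLaw θ P) (hm : 2 ≤ m) (hσ0 : 0 < σm) (hσp : 0 < σp)
    (hσ2 : σp < 1) {s : ℝ}
    (hs0 : 0 < s) (hr : ∀ v : JW m, ∫ ω, rs s ω v ∂P = 1 / m) :
    ∀ᵐ ω ∂P, Good s ω ∧ ∀ k (u : Fin k → Fin m), HasSum (FF s ω k u) (XX s ω k u) := by
  have h : ∀ᵐ ω ∂P, ∀ k, ∀ u : Fin k → Fin m, Summable (FF s ω k u) := by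
    rw [ae_all_iff]; intro k
    rw [ae_all_iff]; intro u
    exact ae_summable_aux (FF_integrable hσ0 hσ2 hs0 k u)
      (FF_summable hP2 hm hσ0 hσp hσ2 hs0 hr k u)
  filter_upwards [h] with ω hω
  refine ⟨fun k u => ⟨_, FF_hasSum s ω k u (hω k u)⟩, fun k u => ?_⟩
  rw [XX_eq hσ0 (FF_hasSum s ω k u (hω k u))]
  exact (hω k u).hasSum

theorem XX_int (hP2 : IsProductLaw θ P) (hm : 2 ≤ m) (hσ0 : 0 < σm) (hσp : 0 < σp)
    (hσ2 : σp < 1) {s : ℝ}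
    (hs0 : 0 < s) (hr : ∀ v : JW m, ∫ ω, rs s ω v ∂P = 1 / m) (k : ℕ) (u : Fin k → Fin m) :
    ∫ ω, XX s ω k u ∂P = 1 := by
  have h1 := hasSum_integral_of_summable_integral_norm (FF_integrable (P := P) hσ0 hσ2 hs0 k u)
    (FF_summable hP2 hm hσ0 hσp hσ2 hs0 hr k u)
  have h2 : HasSum (fun n => ∫ ω, FF s ω k u n ∂P) 1 := by
    have : ∀ n, n ≠ 0 → ∫ ω, FF s ω k u n ∂P = 0 := by
      intro n hn
      obtain ⟨n, rfl⟩ := Nat.exists_eq_succ_of_ne_zero hn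
      exact DD_int hP2 hm hσ0 hσ2 hs0 hr n k u
    have h3 := hasSum_single (f := fun n => ∫ ω, FF s ω k u n ∂P) 0 this
    simpa [FF] using h3
  rw [← h1.unique h2]
  refine integral_congr_ae ?_
  filter_upwards [ae_good hP2 hm hσ0 hσp hσ2 hs0 hr] with ω hω
  exact (hω.2 k u).tsum_eq.symm

theorem XX_integrable (hP2 : IsProductLaw θ P) (hm : 2 ≤ m) (hσ0 : 0 < σm) (hσp : 0 < σp)
    (hσ2 : σp < 1) {s : ℝ}
    (hs0 : 0 < s) (hr : ∀ v : JW m, ∫ ω, rs s ω v ∂P = 1 / m) (k : ℕ) (u : Fin k → Fin m) :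
    Integrable (fun ω => XX s ω k u) P := by
  by_contra h
  have := XX_int hP2 hm hσ0 hσp hσ2 hs0 hr k u
  rw [integral_undef h] at this
  exact zero_ne_one this

theorem zero_iff (hσ0 : 0 < σm) {s : ℝ} {ω : Omega d m σm σp} (hg : Good s ω) (k : ℕ) :
    XX s ω 0 Fin.elim0 = 0 ↔ ∀ u : Fin k → Fin m, XX s ω k u = 0 := by
  induction k with
  | zero =>
    constructor
    · intro h u; rw [← h]; congr 1; exact Subsingleton.elim _ _
    · intro h; exact h _
  | succ k ih =>
    rw [ih]
    constructor
    · intro h u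
      have h1 := h (Fin.init u)
      rw [hg.XX_sum hσ0, Finset.sum_eq_zero_iff_of_nonneg fun a _ =>
        mul_nonneg (rs_pos hσ0 s ω _).le (XX_nonneg s ω _ _)] at h1
      have h2 := h1 (u (Fin.last k)) (Finset.mem_univ _)
      have e : sn (Fin.init u) (u (Fin.last k)) = u := Fin.snoc_init_self u
      rw [e] at h2
      exact (mul_eq_zero.1 h2).resolve_left (rs_pos hσ0 s ω _).ne'
    · intro h u
      rw [hg.XX_sum hσ0]
      exact Finset.sum_eq_zero fun a _ => by rw [h, mul_zero]

theorem ae_pos (hP2 : IsProductLaw θ P) (hm : 2 ≤ m) (hσ0 : 0 < σm) (hσp : 0 < σp)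
    (hσ2 : σp < 1) {s : ℝ}
    (hs0 : 0 < s) (hr : ∀ v : JW m, ∫ ω, rs s ω v ∂P = 1 / m) :
    ∀ᵐ ω ∂P, 0 < XX s ω 0 (Fin.elim0 : Fin 0 → Fin m) := by
  classical
  have hgood := ae_good hP2 hm hσ0 hσp hσ2 hs0 hr
  set u0 : Fin 0 → Fin m := Fin.elim0
  let I : Omega d m σm σp → ℝ := fun ω => if XX s ω 0 u0 = 0 then 1 else 0
  let Ik : ℕ → Omega d m σm σp → ℝ := fun k ω =>
    if ∀ u : Fin k → Fin m, XX s ω k u = 0 then 1 else 0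
  have hIm : Measurable I := Measurable.ite (XX_meas' s 0 u0 (measurableSet_singleton 0))
    measurable_const measurable_const
  have hIk : ∀ k, Measurable[GS d m σm σp {v | k ≤ v.1}] (Ik k) := by
    intro k
    refine Measurable.ite ?_ measurable_const measurable_const
    have : {ω : Omega d m σm σp | ∀ u : Fin k → Fin m, XX s ω k u = 0} =
      ⋂ u : Fin k → Fin m, (fun ω => XX s ω k u) ⁻¹' {0} := by ext; simp
    rw [this]
    refine MeasurableSet.iInter fun u => ?_
    refine XX_meas s k u ?_ (measurableSet_singleton 0)
    rintro v ⟨h, -⟩; exact h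
  have hII : ∀ k, I =ᵐ[P] Ik k := by
    intro k
    filter_upwards [hgood] with ω hω
    simp only [I, Ik, u0, zero_iff hσ0 hω.1 k]
  have hI1 : ∀ ω, ‖I ω‖ ≤ 1 := by
    intro ω; dsimp only [I]; split_ifs <;> simp
  have hIint : Integrable I P := bdd_int hIm 1 hI1
  have hMI : ∀ n, Integrable (fun ω => MM s ω n 0 u0 * I ω) P := fun n =>
    (MM_integrable hσ0 hσ2 hs0 n 0 u0).mul_bdd (c := 1) hIm.aestronglyMeasurable
      (Eventually.of_forall hI1)
  have hM : ∀ n, ∫ ω, MM s ω n 0 u0 * I ω ∂P = ∫ ω, I ω ∂P := by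
    intro n
    calc _ = ∫ ω, MM s ω n 0 u0 * Ik n ω ∂P := by
          refine integral_congr_ae ?_
          filter_upwards [hII n] with ω hω
          rw [hω]
      _ = (∫ ω, MM s ω n 0 u0 ∂P) * ∫ ω, Ik n ω ∂P := by
          refine int_mul hP2 (S := {v | v.1 < n}) ?_
            (MM_meas s n 0 u0 fun v _ hv => by simpa using hv) (hIk n)
          rw [Set.disjoint_left]
          intro v h1 h2
          simp only [Set.mem_ofPred_eq] at h1 h2
          omega
      _ = _ := by
          rw [MM_int hP2 hm hσ0 hσ2 hs0 hr, one_mul, integral_congr_ae (hII n)]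
  have hFint : ∀ n, Integrable (fun ω => FF s ω 0 u0 n * I ω) P := fun n =>
    (FF_integrable hσ0 hσ2 hs0 0 u0 n).mul_bdd (c := 1) hIm.aestronglyMeasurable
      (Eventually.of_forall hI1)
  have hFsum : Summable fun n => ∫ ω, ‖FF s ω 0 u0 n * I ω‖ ∂P := by
    refine Summable.of_nonneg_of_le (fun n => integral_nonneg fun ω => norm_nonneg _)
      (fun n => integral_mono (hFint n).norm (FF_integrable hσ0 hσ2 hs0 0 u0 n).norm fun ω => ?_)
      (FF_summable hP2 hm hσ0 hσp hσ2 hs0 hr 0 u0)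
    dsimp only
    rw [norm_mul]
    exact mul_le_of_le_one_right (norm_nonneg _) (hI1 ω)
  have h1 := hasSum_integral_of_summable_integral_norm hFint hFsum
  have h2 : HasSum (fun n => ∫ ω, FF s ω 0 u0 n * I ω ∂P) (∫ ω, I ω ∂P) := by
    have : ∀ n, n ≠ 0 → ∫ ω, FF s ω 0 u0 n * I ω ∂P = 0 := by
      intro n hn
      obtain ⟨n, rfl⟩ := Nat.exists_eq_succ_of_ne_zero hn
      simp only [FF, DD, sub_mul]
      rw [integral_sub (hMI _) (hMI _), hM, hM, sub_self]
    have h3 := hasSum_single (f := fun n => ∫ ω, FF s ω 0 u0 n * I ω ∂P) 0 this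
    simpa [FF] using h3
  have h3 := h1.unique h2
  have h4 : ∫ ω, ∑' n, FF s ω 0 u0 n * I ω ∂P = 0 := by
    rw [← integral_zero (Omega d m σm σp) ℝ (μ := P)]
    refine integral_congr_ae ?_
    filter_upwards [hgood] with ω hω
    rw [tsum_mul_right, (hω.2 0 u0).tsum_eq]
    dsimp only [I]
    split_ifs with h
    · rw [h, zero_mul]
    · rw [mul_zero]
  rw [h4] at h3
  have h5 := (integral_eq_zero_iff_of_nonneg (fun ω => by
    dsimp only [I]; split_ifs <;> simp) hIint).1 h3.symm
  filter_upwards [h5] with ω hω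
  refine lt_of_le_of_ne (XX_nonneg s ω 0 u0) fun h => ?_
  simp [I, ← h] at hω

theorem wordRs_meas (hσ0 : 0 < σm) (s : ℝ) {k : ℕ} (w : Fin k → Fin m) :
    Measurable[GS d m σm σp {v | v.1 + 1 ≤ k}] (fun ω => wordR ω w ^ s) := by
  have : (fun ω : Omega d m σm σp => wordR ω w ^ s) =
      fun ω => ∏ j : Fin k, rs s ω ⟨j.1, fun t => w (Fin.castLE j.2 t)⟩ := by
    funext ω
    rw [wordR, ← Real.finsetProd_rpow _ _ fun j _ => (lab_pos hσ0 ω _).le]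
    rfl
  rw [this]
  refine Finset.measurable_fun_prod _ fun j _ => rs_meas s ?_
  exact j.2

theorem wordRs_le (hσ0 : 0 < σm) (hσ2 : σp < 1) {s : ℝ} (hs0 : 0 < s) {k : ℕ} (w : Fin k → Fin m)
    (ω : Omega d m σm σp) : ‖wordR ω w ^ s‖ ≤ 1 := by
  rw [Real.norm_eq_abs, abs_of_pos (Real.rpow_pos_of_pos (wordR_pos hσ0 ω w) s)]
  refine Real.rpow_le_one (wordR_pos hσ0 ω w).le ?_ hs0.le
  exact Finset.prod_le_one (fun j _ => (lab_pos hσ0 ω _).le)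
    fun j _ => ((ω _).1.2.2.trans hσ2).le

theorem cyl_sum {m : ℕ} (μ : Measure (ℕ → Fin m)) [IsFiniteMeasure μ] (k : ℕ) :
    ∑ w : Fin k → Fin m, (μ (cyl w)).toReal = (μ Set.univ).toReal := by
  have h : (Set.univ : Set (ℕ → Fin m)) = ⋃ w : Fin k → Fin m, cyl w := by
    symm
    rw [Set.eq_univ_iff_forall]
    intro j
    exact Set.mem_iUnion.2 ⟨fun t => j t, fun t => rfl⟩
  rw [h, measure_iUnion, tsum_fintype, ENNReal.toReal_sum fun w _ => measure_ne_top μ _]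
  · intro w w' hne
    rw [Function.onFun, Set.disjoint_left]
    intro j h1 h2
    apply hne
    funext t
    rw [← h1 t, ← h2 t]
  · exact fun w => cyl_meas w

end Prob3

/-- Lemma 4.3 together with Lemma 4.4 (change-of-label covariance): the random measures
`(μ^ω)` can be chosen so that if `ω, ω'` agree off a single node `w₀`, then
`μ^ω|_{[w₀]} = (r_{w₀}^ω/r_{w₀}^{ω'})^s · μ^{ω'}|_{[w₀]}` and `μ^ω|_{[w₁]} = μ^{ω'}|_{[w₁]}`
for every node `w₁` incomparable with `w₀`. -/
theorem stmt14 (d m : ℕ) (hd : 1 ≤ d) (hm : 2 ≤ m)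
    (σm σp : ℝ) (hσ0 : 0 < σm) (hσ1 : σm ≤ σp) (hσ2 : σp < 1)
    (θ : Measure (Od d)) (hθ1 : IsProbabilityMeasure θ) (hθ2 : θ.IsMulLeftInvariant)
    (P : Measure (Omega d m σm σp)) (hP1 : IsProbabilityMeasure P)
    (hP2 : IsProductLaw θ P)
    (s : ℝ) (hs0 : 0 < s)
    (hs : ((m : ℝ) / (σp - σm)) * (∫ r in σm..σp, r ^ s) = 1) :
    ∃ μ : Omega d m σm σp → Measure (ℕ → Fin m),
      (∀ ω, IsFiniteMeasure (μ ω)) ∧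
      (∀ (k : ℕ) (w : Fin k → Fin m), Measurable fun ω => μ ω (cyl w)) ∧
      (∀ᵐ ω ∂P, 0 < μ ω Set.univ ∧ μ ω Set.univ < ⊤) ∧
      (∀ k : ℕ, 1 ≤ k → ∀ w : Fin k → Fin m,
        MeasureTheory.condExp (Fk d m σm σp k) P (fun ω => (μ ω (cyl w)).toReal)
          =ᵐ[P] fun ω => wordR ω w ^ s) ∧
      (∀ k : ℕ, 1 ≤ k →
        ∫ ω, (∑ w : Fin k → Fin m, (μ ω (cyl w)).toReal) ∂P = 1) ∧
      (∀ ω ω' : Omega d m σm σp, ∀ w₀ : JW m, (∀ w : JW m, w ≠ w₀ → ω w = ω' w) →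
        ((μ ω).restrict (cylNode w₀) =
          ENNReal.ofReal ((((ω w₀).1 : ℝ) / ((ω' w₀).1 : ℝ)) ^ s) •
            (μ ω').restrict (cylNode w₀)) ∧
        ∀ w₁ : JW m, ¬ isPrefix w₀ w₁ → ¬ isPrefix w₁ w₀ →
          (μ ω).restrict (cylNode w₁) = (μ ω').restrict (cylNode w₁)) := by
  classical
  have hr : ∀ v : JW m, ∫ ω, rs s ω v ∂P = 1 / m := rs_int hP2 hm hσ1 hs
  have hσp : 0 < σp := hσ0.trans_le hσ1
  have hgood := ae_good hP2 hm hσ0 hσp hσ2 hs0 hr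
  obtain ⟨μ, h1, h2, h3⟩ := exists_mu (d := d) (σp := σp) hm hσ0 s
  have hae : ∀ (k : ℕ) (w : Fin k → Fin m), (fun ω => (μ ω (cyl w)).toReal) =ᵐ[P]
      fun ω => wordR ω w ^ s * XX s ω k w := by
    intro k w
    filter_upwards [hgood] with ω hω
    rw [h2 ω hω.1, ENNReal.toReal_ofReal]
    exact mul_nonneg (Real.rpow_pos_of_pos (wordR_pos hσ0 ω w) s).le (XX_nonneg s ω k w)
  have hcu : (Set.univ : Set (ℕ → Fin m)) = cyl (Fin.elim0 : Fin 0 → Fin m) := by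
    ext; simp [cyl]
  have hw0 : ∀ ω : Omega d m σm σp, wordR ω (Fin.elim0 : Fin 0 → Fin m) ^ s = 1 := by
    intro ω; simp [wordR]
  refine ⟨μ, h1, ?_, ?_, ?_, ?_, cov_measure hσ0 s μ h1 h2 h3⟩
  · intro k w
    have e : (fun ω => μ ω (cyl w)) =
        fun ω => if Good s ω then ENNReal.ofReal (wordR ω w ^ s * XX s ω k w) else 0 := by
      funext ω
      split_ifs with hg
      · exact h2 ω hg k w
      · rw [h3 ω hg]; rfl
    rw [e]
    refine Measurable.ite (good_meas s) (Measurable.ennreal_ofReal (Measurable.mul ?_ ?_))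
      measurable_const
    · exact (wordRs_meas hσ0 s w).mono (GS_le _) le_rfl
    · exact XX_meas' s k w
  · filter_upwards [hgood, ae_pos hP2 hm hσ0 hσp hσ2 hs0 hr] with ω hω hpos
    have := h1 ω
    refine ⟨?_, measure_lt_top _ _⟩
    rw [hcu, h2 ω hω.1, hw0, one_mul, ENNReal.ofReal_pos]
    exact hpos
  · intro k hk w
    rw [Fk_eq]
    refine (condExp_congr_ae (hae k w)).trans ?_
    have hXi := XX_integrable hP2 hm hσ0 hσp hσ2 hs0 hr k w
    have hc := condExp_mul_of_stronglyMeasurable_left (μ := P)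
      (m := GS d m σm σp {v | v.1 + 1 ≤ k}) (f := fun ω => wordR ω w ^ s)
      (g := fun ω => XX s ω k w) (wordRs_meas hσ0 s w).stronglyMeasurable
      (hXi.bdd_mul (c := 1) ((wordRs_meas hσ0 s w).mono (GS_le _) le_rfl).aestronglyMeasurable
        (Eventually.of_forall (wordRs_le hσ0 hσ2 hs0 w))) hXi
    refine hc.trans ?_
    have hi := MeasureTheory.condExp_indep_eq (μ := P) (GS_le (Below w)) (GS_le {v | v.1 + 1 ≤ k})
      (XX_meas s k w subset_rfl).stronglyMeasurable (GS_indep hP2 (by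
        rw [Set.disjoint_left]
        rintro v ⟨h, -⟩ h'
        simp only [Set.mem_ofPred_eq] at h'
        omega))
    filter_upwards [hi] with ω hω
    rw [Pi.mul_apply, hω, XX_int hP2 hm hσ0 hσp hσ2 hs0 hr, mul_one]
  · intro k hk
    rw [← XX_int hP2 hm hσ0 hσp hσ2 hs0 hr 0 Fin.elim0]
    refine integral_congr_ae ?_
    filter_upwards [hae 0 Fin.elim0] with ω hω
    have := h1 ω
    rw [cyl_sum, hcu, hω, hw0, one_mul]
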